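/- Let N = 2, α ≥ 0, let n ≥ 1 be an integer, set ν = 2n/(2+α), and let z > 0 satisfy J_ν(z) = 0. Define ω on the closed unit disc B̄ by ω(r cos θ, r sin θ) = J_ν(z r^{(2+α)/2}) cos(nθ) for r ∈ [0,1], θ ∈ [−π,π]. Then ω ∈ C²(B) ∩ C(B̄), ω = 0 on ∂B, and −Δω = ((2+α)z/2)² |x|^α ω in B; that is, ω is a classical eigenfunction of the weighted eigenvalue problem with eigenvalue ((2+α)z/2)². -/

import Mathlib

open Real MeasureTheory Metric Filter Topology

noncomputable section

/-- The Euclidean plane. -/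
abbrev E2 := EuclideanSpace ℝ (Fin 2)

/-- The Laplacian of `u : ℝ² → ℝ`. -/
def lap (u : E2 → ℝ) (x : E2) : ℝ :=
  ∑ i : Fin 2, fderiv ℝ (fun y => fderiv ℝ u y (EuclideanSpace.single i 1)) x
    (EuclideanSpace.single i 1)

/-- A classical eigenfunction of the weighted eigenvalue problem with eigenvalue `μ`. -/
def IsEigenfun (α μ : ℝ) (ω : E2 → ℝ) : Prop :=
  ContDiffOn ℝ 2 ω (ball 0 1) ∧ ContinuousOn ω (closedBall 0 1) ∧
  (∃ x ∈ closedBall (0 : E2) 1, ω x ≠ 0) ∧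
  (∀ x ∈ ball (0 : E2) 1, -lap ω x = μ * ‖x‖ ^ α * ω x) ∧
  (∀ x : E2, ‖x‖ = 1 → ω x = 0)

/-- The Bessel function of the first kind of order `β`. -/
def besselJ (β r : ℝ) : ℝ :=
  r ^ β * ∑' k : ℕ,
    ((-1 : ℝ) ^ k / (Nat.factorial k * Real.Gamma ((k : ℝ) + 1 + β))) * (r / 2) ^ (2 * k)

/-- The point of the plane with polar coordinates `(r, θ)`. -/
def polar (r θ : ℝ) : E2 :=
  (EuclideanSpace.equiv (Fin 2) ℝ).symm ![r * Real.cos θ, r * Real.sin θ]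

/-- Coefficients of exponential type: `|a k| ≤ C R ^ k / k!`. -/
def ExpBound (a : ℕ → ℝ) : Prop :=
  ∃ C R : ℝ, 0 ≤ C ∧ 0 ≤ R ∧ ∀ k, |a k| ≤ C * R ^ k / Nat.factorial k

/-- The sum of the power series with coefficients `a`. -/
def powSum (a : ℕ → ℝ) (s : ℝ) : ℝ := ∑' k, a k * s ^ k

/-- The coefficients of the derivative of a power series. -/
def derivCoeff (a : ℕ → ℝ) (k : ℕ) : ℝ := (k + 1) * a (k + 1)

lemma ExpBound.derivCoeff {a : ℕ → ℝ} (h : ExpBound a) : ExpBound (derivCoeff a) := by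
  obtain ⟨C, R, hC, hR, h⟩ := h
  refine ⟨C * R, R, by positivity, hR, fun k => ?_⟩
  have := h (k + 1)
  rw [_root_.derivCoeff, abs_mul, abs_of_nonneg (by positivity : (0 : ℝ) ≤ k + 1)]
  calc ((k : ℝ) + 1) * |a (k + 1)| ≤ (k + 1) * (C * R ^ (k + 1) / Nat.factorial (k + 1)) := by
        gcongr
    _ = C * R * R ^ k / Nat.factorial k := by
        rw [Nat.factorial_succ]; push_cast; field_simp; ring

lemma ExpBound.exists_bound {a : ℕ → ℝ} (h : ExpBound a) (M : ℝ) :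
    ∃ u : ℕ → ℝ, Summable u ∧ ∀ k s, |s| ≤ M → ‖a k * s ^ k‖ ≤ u k := by
  obtain ⟨C, R, hC, hR, h⟩ := h
  refine ⟨fun k => C * ((R * M) ^ k / Nat.factorial k),
    (Real.summable_pow_div_factorial (R * M)).mul_left C, fun k s hs => ?_⟩
  rw [norm_mul, norm_pow, Real.norm_eq_abs, Real.norm_eq_abs]
  calc |a k| * |s| ^ k ≤ (C * R ^ k / Nat.factorial k) * M ^ k := by gcongr; exact h k
    _ = C * ((R * M) ^ k / Nat.factorial k) := by rw [mul_pow]; ring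

lemma ExpBound.summable {a : ℕ → ℝ} (h : ExpBound a) (s : ℝ) : Summable fun k => a k * s ^ k := by
  obtain ⟨u, hu, hb⟩ := h.exists_bound |s|
  exact hu.of_norm_bounded fun k => hb k s le_rfl

lemma ExpBound.hasDerivAt {a : ℕ → ℝ} (h : ExpBound a) (s : ℝ) :
    HasDerivAt (powSum a) (powSum (_root_.derivCoeff a) s) s := by
  obtain ⟨u, hu, hb⟩ := h.derivCoeff.exists_bound (|s| + 1)
  have key : ∀ t, (∑' k, a k * t ^ k) = a 0 + ∑' k, a (k + 1) * t ^ (k + 1) := fun t => by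
    rw [(h.summable t).tsum_eq_zero_add]; simp
  have hd : HasDerivAt (fun t => ∑' k, a (k + 1) * t ^ (k + 1))
      (∑' k, _root_.derivCoeff a k * s ^ k) s := by
    refine hasDerivAt_tsum_of_isPreconnected (𝕜 := ℝ) (F := ℝ)
      (g := fun k t => a (k + 1) * t ^ (k + 1)) (g' := fun k t => _root_.derivCoeff a k * t ^ k)
      (t := Metric.ball (0 : ℝ) (|s| + 1)) (y₀ := s) hu
      Metric.isOpen_ball (convex_ball _ _).isPreconnected (fun k t _ => ?_) (fun k t ht => ?_) ?_ ?_
      ?_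
    · refine ((hasDerivAt_pow (k + 1) t).const_mul (a (k + 1))).congr_deriv ?_
      simp only [_root_.derivCoeff, Nat.add_sub_cancel]; push_cast; ring
    · refine hb k t ?_
      simpa using (mem_ball_zero_iff.1 ht).le
    · simp
    · exact (summable_nat_add_iff 1).2 (h.summable s)
    · simp
  have : powSum a = fun t => a 0 + ∑' k, a (k + 1) * t ^ (k + 1) := funext key
  rw [this]
  exact hd.const_add _

lemma ExpBound.contDiff {a : ℕ → ℝ} (h : ExpBound a) (n : ℕ) : ContDiff ℝ n (powSum a) := by
  induction n generalizing a with
  | zero =>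
    exact contDiff_zero.2 (continuous_iff_continuousAt.2 fun s => (h.hasDerivAt s).continuousAt)
  | succ n ih =>
    have hd : deriv (powSum a) = powSum (_root_.derivCoeff a) :=
      funext fun s => (h.hasDerivAt s).deriv
    push_cast
    refine contDiff_succ_iff_deriv.2 ⟨fun s => (h.hasDerivAt s).differentiableAt, by simp, ?_⟩
    rw [hd]
    exact ih h.derivCoeff

/-- Coefficients in `s = r ^ (2 + α)` of the Bessel series of order `β`. -/
def besselCoeff (β w : ℝ) (k : ℕ) : ℝ :=
  (-1 : ℝ) ^ k / (Nat.factorial k * Real.Gamma ((k : ℝ) + 1 + β)) * w ^ k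

lemma Gamma_one_add_le (β : ℝ) (hβ : 0 ≤ β) (k : ℕ) :
    Real.Gamma (1 + β) ≤ Real.Gamma ((k : ℝ) + 1 + β) := by
  induction k with
  | zero => simp
  | succ k ih =>
    have h : ((k + 1 : ℕ) : ℝ) + 1 + β = ((k : ℝ) + 1 + β) + 1 := by push_cast; ring
    rw [h, Real.Gamma_add_one (by positivity)]
    have := Real.Gamma_pos_of_pos (by positivity : 0 < (k : ℝ) + 1 + β)
    have hk : (0 : ℝ) ≤ k := by positivity
    nlinarith

lemma besselCoeff_expBound (β w : ℝ) (hβ : 0 ≤ β) (hw : 0 ≤ w) : ExpBound (besselCoeff β w) := by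
  have h0 := Real.Gamma_pos_of_pos (by positivity : 0 < 1 + β)
  refine ⟨1 / Real.Gamma (1 + β), w, by positivity, hw, fun k => ?_⟩
  have h1 := Gamma_one_add_le β hβ k
  have h2 := h0.trans_le h1
  rw [besselCoeff, abs_mul, abs_div, abs_pow, abs_pow, abs_neg, abs_one, one_pow,
    abs_of_pos (by positivity : 0 < (Nat.factorial k : ℝ) * Real.Gamma ((k : ℝ) + 1 + β)),
    abs_of_nonneg hw]
  calc 1 / ((Nat.factorial k : ℝ) * Real.Gamma ((k : ℝ) + 1 + β)) * w ^ k
      ≤ 1 / ((Nat.factorial k : ℝ) * Real.Gamma (1 + β)) * w ^ k := by gcongr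
    _ = _ := by field_simp

lemma besselCoeff_succ (β w : ℝ) (hβ : 0 ≤ β) (k : ℕ) :
    ((k : ℝ) + 1) * (k + 1 + β) * besselCoeff β w (k + 1) = -w * besselCoeff β w k := by
  have h : ((k + 1 : ℕ) : ℝ) + 1 + β = ((k : ℝ) + 1 + β) + 1 := by push_cast; ring
  have h0 := Real.Gamma_pos_of_pos (by positivity : 0 < (k : ℝ) + 1 + β)
  rw [besselCoeff, besselCoeff, h, Real.Gamma_add_one (by positivity), Nat.factorial_succ]
  push_cast
  have : (k : ℝ) + 1 + β ≠ 0 := by positivity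
  field_simp
  ring

/-- The ordinary differential equation of the Bessel series in the variable `s`. -/
lemma powSum_besselCoeff_ode (β w : ℝ) (hβ : 0 ≤ β) (hw : 0 ≤ w) (s : ℝ) :
    s * powSum (derivCoeff (derivCoeff (besselCoeff β w))) s
      + (1 + β) * powSum (derivCoeff (besselCoeff β w)) s + w * powSum (besselCoeff β w) s = 0 := by
  have hb := besselCoeff_expBound β w hβ hw
  set a := besselCoeff β w with ha
  have s0 := hb.summable s
  have s1 := hb.derivCoeff.summable s
  have s2 := hb.derivCoeff.derivCoeff.summable s
  have s3 : HasSum (fun k : ℕ => (k : ℝ) * derivCoeff a k * s ^ k)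
      (s * powSum (derivCoeff (derivCoeff a)) s) := by
    rw [← hasSum_nat_add_iff' 1, Finset.sum_range_one, Nat.cast_zero, zero_mul, zero_mul, sub_zero]
    refine (s2.hasSum.mul_left s).congr_fun fun k => ?_
    rw [derivCoeff.eq_1 (derivCoeff a)]; push_cast; ring
  have h := (s3.add (s1.hasSum.mul_left (1 + β))).add (s0.hasSum.mul_left w)
  refine h.unique ?_
  convert hasSum_zero using 1
  ext k
  have := besselCoeff_succ β w hβ k
  rw [← ha] at this
  rw [derivCoeff]
  linear_combination s ^ k * this

lemma besselJ_mul_rpow (α : ℝ) (hα : 0 ≤ α) (n : ℕ) (z : ℝ) (hz : 0 < z) (r : ℝ) (hr : 0 ≤ r) :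
    besselJ (2 * (n : ℝ) / (2 + α)) (z * r ^ ((2 + α) / 2)) =
      z ^ (2 * (n : ℝ) / (2 + α)) * r ^ n *
        powSum (besselCoeff (2 * (n : ℝ) / (2 + α)) (z ^ 2 / 4)) (r ^ (2 + α)) := by
  have h1 : (r ^ ((2 + α) / 2)) ^ (2 * (n : ℝ) / (2 + α)) = r ^ n := by
    rw [← Real.rpow_mul hr, ← Real.rpow_natCast]
    congr 1
    field_simp
  have h2 : (r ^ ((2 + α) / 2)) ^ 2 = r ^ (2 + α) := by
    rw [← Real.rpow_natCast, ← Real.rpow_mul hr]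
    congr 1
    push_cast; ring
  rw [besselJ, powSum, Real.mul_rpow hz.le (by positivity), h1]
  congr 1
  refine tsum_congr fun k => ?_
  rw [besselCoeff, mul_assoc, ← mul_pow, pow_mul, ← h2]
  congr 2
  ring

lemma mul_rpow_sub_two_mul_sq {α r : ℝ} (hα : 0 ≤ α) (hr : 0 ≤ r) :
    α * r ^ (α - 2) * r ^ 2 = α * r ^ α := by
  rcases hr.eq_or_lt with rfl | hr
  · rcases hα.eq_or_lt with rfl | hα
    · simp
    · simp [Real.zero_rpow hα.ne']
  · rw [mul_assoc, ← Real.rpow_natCast, ← Real.rpow_add hr]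
    norm_num

section NormRpow

variable {E : Type*} [NormedAddCommGroup E] [InnerProductSpace ℝ E]

/-- The derivative of `x ↦ ‖x‖ ^ α • x`. -/
def normRpowSMulDeriv (α : ℝ) (x : E) : E →L[ℝ] E :=
  ‖x‖ ^ α • ContinuousLinearMap.id ℝ E + (α * ‖x‖ ^ (α - 2)) • (innerSL ℝ x).smulRight x

lemma hasFDerivAt_norm_rpow_of_ne_zero (α : ℝ) {x : E} (hx : x ≠ 0) :
    HasFDerivAt (fun y : E => ‖y‖ ^ α) ((α * ‖x‖ ^ (α - 2)) • innerSL ℝ x) x := by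
  have hx' : 0 < ‖x‖ := norm_pos_iff.2 hx
  have h := (hasStrictFDerivAt_norm_sq x).hasFDerivAt.rpow_const (p := α / 2)
    (Or.inl (by positivity))
  have h2 : ∀ (y : E) (b : ℝ), (‖y‖ ^ 2) ^ b = ‖y‖ ^ (2 * b) := fun y b => by
    rw [← Real.rpow_natCast, ← Real.rpow_mul (norm_nonneg y)]; norm_num
  simp only [h2] at h
  convert h using 1
  · ext y; congr 1; ring
  · ext y
    simp only [smul_apply, nsmul_eq_mul, smul_eq_mul]
    rw [show 2 * (α / 2 - 1) = α - 2 by ring]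
    push_cast; ring

lemma hasFDerivAt_norm_rpow_smul {α : ℝ} (hα : 0 ≤ α) (x : E) :
    HasFDerivAt (fun y : E => ‖y‖ ^ α • y) (normRpowSMulDeriv α x) x := by
  rcases eq_or_ne x 0 with rfl | hx
  · rcases hα.eq_or_lt with rfl | hα
    · simpa [normRpowSMulDeriv, Function.id_def] using (ContinuousLinearMap.id ℝ E).hasFDerivAt (x := 0)
    · have h0 : normRpowSMulDeriv α (0 : E) = 0 := by
        ext; simp [normRpowSMulDeriv, Real.zero_rpow hα.ne']
      rw [h0]
      refine HasFDerivAt.of_isLittleO ?_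
      have h1 : (fun y : E => ‖y‖ ^ α) =o[𝓝 0] fun _ => (1 : ℝ) := by
        rw [Asymptotics.isLittleO_one_iff]
        have : Continuous fun y : E => ‖y‖ ^ α := continuous_norm.rpow_const fun _ => Or.inr hα.le
        simpa [Real.zero_rpow hα.ne'] using this.tendsto 0
      simpa using h1.smul_isBigO (Asymptotics.isBigO_refl (fun y : E => y) (𝓝 0))
  · refine ((hasFDerivAt_norm_rpow_of_ne_zero α hx).fun_smul
      (ContinuousLinearMap.id ℝ E).hasFDerivAt).congr_fderiv ?_
    ext h
    simp [normRpowSMulDeriv, smul_smul]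

lemma norm_normRpowSMulDeriv_le {α : ℝ} (hα : 0 ≤ α) (x : E) :
    ‖normRpowSMulDeriv α x‖ ≤ (1 + α) * ‖x‖ ^ α := by
  refine ContinuousLinearMap.opNorm_le_bound _ (by positivity) fun h => ?_
  have h1 := abs_real_inner_le_norm x h
  calc ‖normRpowSMulDeriv α x h‖
      = ‖‖x‖ ^ α • h + (α * ‖x‖ ^ (α - 2)) • (inner ℝ x h • x)‖ := rfl
    _ ≤ ‖x‖ ^ α * ‖h‖ + (α * ‖x‖ ^ (α - 2)) * (‖x‖ * ‖h‖ * ‖x‖) := by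
        refine (norm_add_le _ _).trans ?_
        rw [norm_smul, norm_smul, norm_smul, Real.norm_of_nonneg (by positivity),
          Real.norm_of_nonneg (by positivity : 0 ≤ α * ‖x‖ ^ (α - 2)), Real.norm_eq_abs]
        gcongr
    _ = ‖x‖ ^ α * ‖h‖ + (α * ‖x‖ ^ (α - 2) * ‖x‖ ^ 2) * ‖h‖ := by ring
    _ = (1 + α) * ‖x‖ ^ α * ‖h‖ := by
        rw [mul_rpow_sub_two_mul_sq hα (norm_nonneg x)]; ring

lemma contDiff_norm_rpow_smul {α : ℝ} (hα : 0 ≤ α) : ContDiff ℝ 1 fun x : E => ‖x‖ ^ α • x := by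
  rcases hα.eq_or_lt with rfl | hα'
  · simpa using contDiff_fun_id
  have hf : fderiv ℝ (fun x : E => ‖x‖ ^ α • x) = normRpowSMulDeriv α :=
    funext fun x => (hasFDerivAt_norm_rpow_smul hα x).fderiv
  refine contDiff_one_iff_fderiv.2
    ⟨fun x => (hasFDerivAt_norm_rpow_smul hα x).differentiableAt, ?_⟩
  refine continuous_iff_continuousAt.2 fun x => ?_
  rcases eq_or_ne x 0 with rfl | hx
  · have h0 : normRpowSMulDeriv α (0 : E) = 0 := by
      ext; simp [normRpowSMulDeriv, Real.zero_rpow hα'.ne']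
    rw [hf, ContinuousAt, h0]
    refine squeeze_zero_norm (norm_normRpowSMulDeriv_le hα) ?_
    have : Continuous fun y : E => (1 + α) * ‖y‖ ^ α :=
      continuous_const.mul (continuous_norm.rpow_const fun _ => Or.inr hα)
    simpa [Real.zero_rpow hα'.ne'] using this.tendsto 0
  · have hc : ContDiffAt ℝ 1 (fun x : E => ‖x‖ ^ α • x) x :=
      ((contDiffAt_norm ℝ hx).rpow_const_of_ne (norm_ne_zero_iff.2 hx)).smul contDiffAt_id
    exact (hc.fderiv_right (m := 0) (by simp)).continuousAt

lemma contDiff_two_norm_rpow {α : ℝ} (hα : 0 ≤ α) :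
    ContDiff ℝ 2 fun x : E => ‖x‖ ^ (2 + α) := by
  have h := (contDiff_succ_iff_hasFDerivAt (𝕜 := ℝ) (f := fun x : E => ‖x‖ ^ (2 + α)) (n := 1)).2
    ⟨fun x => (2 + α) • innerSL ℝ (‖x‖ ^ α • x), ?_, fun x => ?_⟩
  · simpa [one_add_one_eq_two] using h
  · exact ((innerSL ℝ).contDiff.comp (contDiff_norm_rpow_smul hα)).const_smul _
  · have h := hasFDerivAt_norm_rpow x (by linarith : 1 < 2 + α)
    rwa [add_sub_cancel_left, ← smul_smul, ← map_smul] at h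

end NormRpow

/-- The identification of the plane with `ℂ`. -/
def toComplex : E2 →L[ℝ] ℂ :=
  (EuclideanSpace.proj (0 : Fin 2) : E2 →L[ℝ] ℝ).smulRight (1 : ℂ) +
    (EuclideanSpace.proj (1 : Fin 2) : E2 →L[ℝ] ℝ).smulRight Complex.I

lemma toComplex_apply (x : E2) : toComplex x = x 0 + x 1 * Complex.I := by
  simp [toComplex]

lemma toComplex_polar (r θ : ℝ) :
    toComplex (polar r θ) = r * (Complex.cos θ + Complex.sin θ * Complex.I) := by
  simp [toComplex_apply, polar]
  ring

lemma norm_toComplex (x : E2) : ‖toComplex x‖ = ‖x‖ := by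
  rw [toComplex_apply, EuclideanSpace.norm_eq, Complex.norm_add_mul_I]
  simp [Fin.sum_univ_two]

lemma toComplex_injective : Function.Injective toComplex :=
  (injective_iff_map_eq_zero _).2 fun x hx => by rw [← norm_eq_zero, ← norm_toComplex, hx, norm_zero]

lemma polar_arg (x : E2) : polar ‖x‖ (toComplex x).arg = x := by
  apply toComplex_injective
  rw [toComplex_polar, ← norm_toComplex, Complex.norm_mul_cos_add_sin_mul_I]

lemma re_toComplex_polar_pow (r θ : ℝ) (n : ℕ) :
    ((toComplex (polar r θ)) ^ n).re = r ^ n * Real.cos (n * θ) := by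
  rw [toComplex_polar, mul_pow, Complex.cos_add_sin_mul_I_pow]
  norm_cast
  rw [Complex.re_ofReal_mul]
  simp [-Complex.ofReal_cos, -Complex.ofReal_sin]

lemma hasFDerivAt_re_mul_toComplex_pow (c : ℂ) (m : ℕ) (x : E2) :
    HasFDerivAt (fun y => (c * toComplex y ^ m).re)
      (Complex.reCLM.comp ((c * (m * toComplex x ^ (m - 1))) • toComplex)) x := by
  have h := (HasFDerivAt.pow (toComplex.hasFDerivAt (x := x)) m).const_mul c
  rw [smul_smul, nsmul_eq_mul] at h
  exact Complex.reCLM.hasFDerivAt.comp x h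

lemma lap_re_pow_mul {α : ℝ} (hα : 0 ≤ α) (m : ℕ) {g g₁ g₂ : ℝ → ℝ}
    (hg : ∀ s, HasDerivAt g (g₁ s) s) (hg₁ : ∀ s, HasDerivAt g₁ (g₂ s) s) (x : E2) :
    lap (fun y => (toComplex y ^ (m + 1)).re * g (‖y‖ ^ (2 + α))) x =
      (toComplex x ^ (m + 1)).re * ‖x‖ ^ α * (2 + α) *
        ((2 + α) * (‖x‖ ^ (2 + α) * g₂ (‖x‖ ^ (2 + α))) +
          (2 + α + 2 * (m + 1)) * g₁ (‖x‖ ^ (2 + α))) := by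
  have hs : ∀ y : E2, HasFDerivAt (fun y : E2 => ‖y‖ ^ (2 + α))
      (((2 + α) * ‖y‖ ^ α) • innerSL ℝ y) y := fun y => by
    have h := hasFDerivAt_norm_rpow y (by linarith : 1 < 2 + α)
    rwa [add_sub_cancel_left] at h
  have hP : ∀ y : E2, HasFDerivAt (fun y => (toComplex y ^ (m + 1)).re)
      (Complex.reCLM.comp (((m + 1 : ℂ) * toComplex y ^ m) • toComplex)) y := fun y => by
    simpa using hasFDerivAt_re_mul_toComplex_pow 1 (m + 1) y
  have hd : ∀ (i : Fin 2) (y : E2),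
      fderiv ℝ (fun y => (toComplex y ^ (m + 1)).re * g (‖y‖ ^ (2 + α))) y
        (EuclideanSpace.single i 1) =
      (toComplex y ^ (m + 1)).re * (g₁ (‖y‖ ^ (2 + α)) * ((2 + α) * (‖y‖ ^ α • y) i)) +
        g (‖y‖ ^ (2 + α)) *
          (((m + 1) * toComplex (EuclideanSpace.single i 1)) * toComplex y ^ m).re := fun i y => by
    have h := (hP y).mul ((hg _).comp_hasFDerivAt y (hs y))
    refine (congrArg (fun A => A (EuclideanSpace.single i 1)) h.fderiv).trans ?_
    have e1 : (((m + 1 : ℂ) * toComplex y ^ m) * toComplex (EuclideanSpace.single i 1)).re =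
      (((m + 1) * toComplex (EuclideanSpace.single i 1)) * toComplex y ^ m).re := by ring_nf
    simp only [add_apply, smul_apply, ContinuousLinearMap.comp_apply, Complex.reCLM_apply,
      smul_eq_mul, innerSL_apply_apply, e1, EuclideanSpace.inner_single_right, PiLp.smul_apply,
      Function.comp, conj_trivial]
    ring
  have hV : ∀ i : Fin 2, HasFDerivAt (fun y : E2 => (‖y‖ ^ α • y) i)
      ((EuclideanSpace.proj i : E2 →L[ℝ] ℝ).comp (normRpowSMulDeriv α x)) x := fun i =>
    (EuclideanSpace.proj i : E2 →L[ℝ] ℝ).hasFDerivAt.comp x (hasFDerivAt_norm_rpow_smul hα x)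
  have hdd : ∀ i : Fin 2, fderiv ℝ (fun y =>
      fderiv ℝ (fun y => (toComplex y ^ (m + 1)).re * g (‖y‖ ^ (2 + α))) y
        (EuclideanSpace.single i 1)) x (EuclideanSpace.single i 1) =
      2 * (((m + 1) * toComplex (EuclideanSpace.single i 1)) * toComplex x ^ m).re *
          (g₁ (‖x‖ ^ (2 + α)) * ((2 + α) * (‖x‖ ^ α * x i))) +
        (toComplex x ^ (m + 1)).re *
          (g₂ (‖x‖ ^ (2 + α)) * ((2 + α) * (‖x‖ ^ α * x i)) ^ 2 +
            g₁ (‖x‖ ^ (2 + α)) * ((2 + α) * (‖x‖ ^ α + α * ‖x‖ ^ (α - 2) * x i ^ 2))) +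
        g (‖x‖ ^ (2 + α)) * (((m + 1) * toComplex (EuclideanSpace.single i 1)) *
          (m * toComplex x ^ (m - 1)) * toComplex (EuclideanSpace.single i 1)).re := fun i => by
    simp only [hd i]
    have h := ((hP x).mul (((hg₁ _).comp_hasFDerivAt x (hs x)).mul
      ((hV i).const_mul (2 + α)))).add (((hg _).comp_hasFDerivAt x (hs x)).mul
      (hasFDerivAt_re_mul_toComplex_pow ((m + 1) * toComplex (EuclideanSpace.single i 1)) m x))
    refine (congrArg (fun A => A (EuclideanSpace.single i 1)) h.fderiv).trans ?_
    have e1 : (((m + 1 : ℂ) * toComplex x ^ m) * toComplex (EuclideanSpace.single i 1)).re =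
      (((m + 1) * toComplex (EuclideanSpace.single i 1)) * toComplex x ^ m).re := by ring_nf
    simp only [add_apply, smul_apply, ContinuousLinearMap.comp_apply, normRpowSMulDeriv,
      Complex.reCLM_apply, smul_eq_mul, innerSL_apply_apply, ContinuousLinearMap.smulRight_apply,
      ContinuousLinearMap.id_apply, e1, EuclideanSpace.inner_single_right, PiLp.proj_apply,
      PiLp.add_apply, PiLp.smul_apply, PiLp.single_apply, if_true, Function.comp, conj_trivial,
      Pi.mul_apply]
    ring
  have hr := mul_rpow_sub_two_mul_sq hα (norm_nonneg x)
  have hn : ‖x‖ ^ 2 = x 0 ^ 2 + x 1 ^ 2 := by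
    rw [EuclideanSpace.norm_sq_eq]; simp [Fin.sum_univ_two]
  have hp : ‖x‖ ^ (2 + α) = ‖x‖ ^ 2 * ‖x‖ ^ α := by
    rw [Real.rpow_add' (norm_nonneg x) (by positivity)]; norm_num
  have h0 : toComplex (EuclideanSpace.single 0 1) = 1 := by simp [toComplex_apply]
  have h1 : toComplex (EuclideanSpace.single 1 1) = Complex.I := by simp [toComplex_apply]
  have hE : (((m + 1 : ℂ) * 1) * toComplex x ^ m).re * x 0 +
      (((m + 1 : ℂ) * Complex.I) * toComplex x ^ m).re * x 1 =
      (m + 1) * (toComplex x ^ (m + 1)).re := by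
    have : (m + 1 : ℂ) * toComplex x ^ (m + 1) = (((m + 1 : ℂ) * 1) * toComplex x ^ m) * x 0 +
      (((m + 1 : ℂ) * Complex.I) * toComplex x ^ m) * x 1 := by
      rw [pow_succ]; nth_rewrite 2 [toComplex_apply]; ring
    have := congrArg Complex.re this
    rw [Complex.add_re, Complex.re_mul_ofReal, Complex.re_mul_ofReal] at this
    rw [← this, ← Complex.re_ofReal_mul]
    push_cast; rfl
  have hH : (((m + 1 : ℂ) * 1) * (m * toComplex x ^ (m - 1)) * 1).re +
      (((m + 1 : ℂ) * Complex.I) * (m * toComplex x ^ (m - 1)) * Complex.I).re = 0 := by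
    rw [← Complex.add_re]
    convert Complex.zero_re using 2
    linear_combination ((m + 1 : ℂ) * (m * toComplex x ^ (m - 1))) * Complex.I_sq
  rw [lap, Fin.sum_univ_two, hdd, hdd, h0, h1]
  generalize g (‖x‖ ^ (2 + α)) = G at *
  generalize g₁ (‖x‖ ^ (2 + α)) = G₁ at *
  generalize g₂ (‖x‖ ^ (2 + α)) = G₂ at *
  rw [hp]
  rw [hn] at hr ⊢
  linear_combination 2 * G₁ * (2 + α) * ‖x‖ ^ α * hE + G * hH +
    (toComplex x ^ (m + 1)).re * G₁ * (2 + α) * hr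

/-- in dimension 2, the function `ω(r cos θ, r sin θ) =
J_ν(z r^{(2+α)/2}) cos(nθ)` with `ν = 2n/(2+α)` and `J_ν(z) = 0` is a classical
eigenfunction of the weighted problem with eigenvalue `((2+α)z/2)²`. -/
theorem stmt_3 (α : ℝ) (hα : 0 ≤ α) (n : ℕ) (hn : 1 ≤ n) (z : ℝ) (hz : 0 < z)
    (hzzero : besselJ (2 * (n : ℝ) / (2 + α)) z = 0)
    (ω : E2 → ℝ)
    (hω : ∀ r ∈ Set.Icc (0 : ℝ) 1, ∀ θ ∈ Set.Icc (-π) π,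
      ω (polar r θ) =
        besselJ (2 * (n : ℝ) / (2 + α)) (z * r ^ ((2 + α) / 2)) * Real.cos (n * θ)) :
    IsEigenfun α (((2 + α) * z / 2) ^ 2) ω := by
  obtain ⟨m, rfl⟩ : ∃ m, n = m + 1 := ⟨n - 1, by omega⟩
  set ν : ℝ := 2 * ((m + 1 : ℕ) : ℝ) / (2 + α) with hν
  have hν0 : 0 ≤ ν := by positivity
  set a : ℕ → ℝ := besselCoeff ν (z ^ 2 / 4) with ha
  have hb : ExpBound a := besselCoeff_expBound ν _ hν0 (by positivity)
  set u : E2 → ℝ := fun y =>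
    (toComplex y ^ (m + 1)).re * (z ^ ν * powSum a (‖y‖ ^ (2 + α))) with hu
  have hωu : ∀ x ∈ closedBall (0 : E2) 1, ω x = u x := fun x hx => by
    have h := hω ‖x‖ ⟨norm_nonneg x, mem_closedBall_zero_iff.1 hx⟩ (toComplex x).arg
      ⟨(Complex.neg_pi_lt_arg _).le, Complex.arg_le_pi _⟩
    have h2 := re_toComplex_polar_pow ‖x‖ (toComplex x).arg (m + 1)
    rw [polar_arg] at h h2
    rw [h, hu, besselJ_mul_rpow α hα (m + 1) z hz _ (norm_nonneg x)]
    simp only [h2]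
    ring
  have hcd : ContDiff ℝ 2 u := by
    refine (Complex.reCLM.contDiff.comp (toComplex.contDiff.pow (m + 1))).mul
      (contDiff_const.mul ?_)
    exact (hb.contDiff 2).comp (contDiff_two_norm_rpow hα)
  have hz1 : powSum a 1 = 0 := by
    have h := besselJ_mul_rpow α hα (m + 1) z hz 1 zero_le_one
    simp only [Real.one_rpow, one_pow, mul_one] at h
    rw [← hν, hzzero] at h
    exact (mul_eq_zero.1 h.symm).resolve_left (by positivity)
  refine ⟨hcd.contDiffOn.congr fun x hx => hωu x (ball_subset_closedBall hx),
    hcd.continuous.continuousOn.congr hωu, ?_, fun x hx => ?_, fun x hx => ?_⟩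
  · have h0 : powSum a 0 ≠ 0 := by
      rw [powSum, tsum_eq_single 0 fun k hk => by simp [hk]]
      have := Real.Gamma_pos_of_pos (by positivity : 0 < 1 + ν)
      simp [ha, besselCoeff, this.ne']
    have hcont : Continuous fun r : ℝ => powSum a (r ^ (2 + α)) :=
      (hb.contDiff 0).continuous.comp (Real.continuous_rpow_const (by positivity))
    have hev : ∀ᶠ r : ℝ in 𝓝 0, powSum a (r ^ (2 + α)) ≠ 0 := by
      refine hcont.continuousAt.eventually_ne ?_
      rwa [Real.zero_rpow (by positivity)]
    have hev' : ∀ᶠ r : ℝ in 𝓝[>] 0, r < 1 ∧ 0 < r ∧ powSum a (r ^ (2 + α)) ≠ 0 :=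
      ((eventually_lt_nhds one_pos).filter_mono nhdsWithin_le_nhds).and
        (eventually_mem_nhdsWithin.and (hev.filter_mono nhdsWithin_le_nhds))
    obtain ⟨r, hr1, hr0, hr⟩ := hev'.exists
    have hnorm : ‖polar r 0‖ = r := by
      rw [← norm_toComplex, toComplex_polar]; simp [abs_of_pos hr0]
    have hmem : polar r 0 ∈ closedBall (0 : E2) 1 :=
      mem_closedBall_zero_iff.2 (hnorm.trans_le hr1.le)
    refine ⟨polar r 0, hmem, ?_⟩
    rw [hωu _ hmem, hu]
    simp only [re_toComplex_polar_pow, hnorm, mul_zero, Real.cos_zero, mul_one]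
    exact mul_ne_zero (by positivity) (mul_ne_zero (by positivity) hr)
  · have heq : ω =ᶠ[𝓝 x] u := by
      filter_upwards [isOpen_ball.mem_nhds hx] with y hy using hωu y (ball_subset_closedBall hy)
    have hlap : lap ω x = lap u x := by
      refine Finset.sum_congr rfl fun i _ => ?_
      have h : (fun y => fderiv ℝ ω y (EuclideanSpace.single i 1)) =ᶠ[𝓝 x]
          fun y => fderiv ℝ u y (EuclideanSpace.single i 1) := by
        filter_upwards [heq.fderiv (𝕜 := ℝ)] with y hy
        rw [hy]
      rw [h.fderiv_eq]
    rw [hlap, hωu x (ball_subset_closedBall hx), hu,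
      lap_re_pow_mul hα m (g := fun s => z ^ ν * powSum a s)
        (fun s => (hb.hasDerivAt s).const_mul _)
        (fun s => (hb.derivCoeff.hasDerivAt s).const_mul _) x]
    have hode := powSum_besselCoeff_ode ν (z ^ 2 / 4) hν0 (by positivity) (‖x‖ ^ (2 + α))
    rw [← ha] at hode
    have hmul : (2 + α) * ν = 2 * (m + 1) := by
      rw [hν]; push_cast; field_simp
    rw [← hmul]
    linear_combination (-(toComplex x ^ (m + 1)).re * ‖x‖ ^ α * (2 + α) ^ 2 * z ^ ν) * hode
  · rw [hωu x (mem_closedBall_zero_iff.2 hx.le), hu]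
    simp only [hx, Real.one_rpow, hz1, mul_zero]
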